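/- Restriction (trace) lemma on the boost region: Let n ≥ 1, θ ∈ (0,1], s ∈ ℕ and δ ∈ ℝ. There exists a constant C, depending only on n, θ, s, δ, such that for every τ ∈ (−θ, θ) and every smooth u : Ω_θ → ℝ with ‖u‖_{H_{s+1,δ}(Ω_θ)} < ∞, the restrictions of the time derivatives of u to the slice Σ_τ = {(x, τσ(x)) : x ∈ ℝⁿ} satisfy Σ_{k=0}^{s} ‖ x ↦ (∂_t^k u)(x, τσ(x)) ‖²_{H_{s−k, δ+1/2+k}(ℝⁿ)} ≤ C ‖u‖²_{H_{s+1,δ}(Ω_θ)}. -/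

import Mathlib

open MeasureTheory

/-- The boost region `Ω_θ = {(x,t) ∈ ℝⁿ×ℝ : |t| ≤ θσ(x)}` where `σ(x) = (1+|x|²)^{1/2}`. -/
def boostRegion (n : ℕ) (θ : ℝ) : Set (EuclideanSpace ℝ (Fin n) × ℝ) :=
  {p | |p.2| ≤ θ * Real.sqrt (1 + ‖p.1‖ ^ 2)}

/-- The weighted Sobolev norm on a set `U ⊆ ℝⁿ×ℝ`, valued in `ℝ≥0∞`, with weight in the
spatial variable only. -/
noncomputable def wSobOn (n s : ℕ) (δ : ℝ) (U : Set (EuclideanSpace ℝ (Fin n) × ℝ))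
    (u : EuclideanSpace ℝ (Fin n) × ℝ → ℝ) : ENNReal :=
  (∑ k ∈ Finset.range (s + 1),
    ∫⁻ p in U,
      ENNReal.ofReal ((1 + ‖p.1‖ ^ 2) ^ (δ + (k : ℝ)) * ‖iteratedFDeriv ℝ k u p‖ ^ 2)) ^ (1/2 : ℝ)

/-- The weighted Sobolev norm `‖v‖_{H_{s,δ}(ℝⁿ)}` of a spatial function, valued in `ℝ≥0∞`. -/
noncomputable def wSob (n s : ℕ) (δ : ℝ) (v : EuclideanSpace ℝ (Fin n) → ℝ) : ENNReal :=
  (∑ k ∈ Finset.range (s + 1),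
    ∫⁻ x : EuclideanSpace ℝ (Fin n),
      ENNReal.ofReal ((1 + ‖x‖ ^ 2) ^ (δ + (k : ℝ)) * ‖iteratedFDeriv ℝ k v x‖ ^ 2)) ^ (1/2 : ℝ)

/-- The partial derivative `∂_t` in the time (second) variable. -/
noncomputable def timeDeriv {n : ℕ} (u : EuclideanSpace ℝ (Fin n) × ℝ → ℝ) :
    EuclideanSpace ℝ (Fin n) × ℝ → ℝ :=
  fun p => deriv (fun t => u (p.1, t)) p.2

open scoped Nat

section CompositionBound

variable {E F G : Type*} [NormedAddCommGroup E] [NormedSpace ℝ E] [NormedAddCommGroup F]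
  [NormedSpace ℝ F] [NormedAddCommGroup G] [NormedSpace ℝ G]

/-- A scaled version of `norm_iteratedFDeriv_comp_le`. -/
theorem norm_iteratedFDeriv_comp_le_of_scaled {g : F → G} {f : E → F} {n : ℕ} {t : Set F}
    (ht : IsOpen t) (hft : ∀ x, f x ∈ t) (hg : ContDiffOn ℝ n g t) (hf : ContDiff ℝ n f)
    (x : E) {C D μ : ℝ} (hμ : 0 < μ)
    (hC : ∀ i ≤ n, μ ^ i * ‖iteratedFDeriv ℝ i g (f x)‖ ≤ C)
    (hD : ∀ i, 1 ≤ i → i ≤ n → ‖iteratedFDeriv ℝ i f x‖ ≤ μ * D ^ i) :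
    ‖iteratedFDeriv ℝ n (g ∘ f) x‖ ≤ n ! * C * D ^ n := by
  let L : F →L[ℝ] F := μ • ContinuousLinearMap.id ℝ F
  have hL : ∀ y, L (μ⁻¹ • y) = y := fun y => by simp [L, smul_smul, hμ.ne']
  have hLn : ‖L‖ ≤ μ := by
    refine L.opNorm_le_bound hμ.le fun y => ?_
    simp [L, norm_smul, abs_of_pos hμ]
  have ht' : IsOpen (L ⁻¹' t) := ht.preimage L.continuous
  have hcomp : g ∘ f = (g ∘ L) ∘ (μ⁻¹ • f) := by
    ext y
    simp [hL]
  rw [hcomp]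
  refine norm_iteratedFDeriv_comp_le' (N := n) (t := L ⁻¹' t) ?_ ht'.uniqueDiffOn
    (hg.comp L.contDiff.contDiffOn (Set.mapsTo_preimage _ _)) (hf.const_smul _) le_rfl x ?_ ?_
  · rintro _ ⟨y, rfl⟩
    simpa [hL] using hft y
  · intro i hi
    have hmem : L (μ⁻¹ • f x) ∈ t := by simpa [hL] using hft x
    rw [L.iteratedFDerivWithin_comp_right hg ht.uniqueDiffOn ht'.uniqueDiffOn hmem
      (by exact_mod_cast hi)]
    refine (ContinuousMultilinearMap.norm_compContinuousLinearMap_le _ _).trans ?_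
    rw [iteratedFDerivWithin_of_isOpen i ht hmem]
    simp only [hL, Finset.prod_const, Finset.card_univ, Fintype.card_fin]
    calc _ ≤ ‖iteratedFDeriv ℝ i g (f x)‖ * μ ^ i := by gcongr
      _ ≤ C := by rw [mul_comm]; exact hC i hi
  · intro i h1 hi
    rw [iteratedFDeriv_const_smul_apply' (hf.contDiffAt.of_le (by exact_mod_cast hi)), norm_smul,
      norm_inv, Real.norm_of_nonneg hμ.le, inv_mul_le_iff₀ hμ]
    exact hD i h1 hi

theorem norm_iteratedFDeriv_id_le (i : ℕ) (x : E) {σ : ℝ} (hσ : 0 < σ) (hx : ‖x‖ ≤ σ) :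
    ‖iteratedFDeriv ℝ i (fun y : E => y) x‖ ≤ σ * σ⁻¹ ^ i := by
  rcases i with _ | _ | i
  · simpa using hx
  · rw [zero_add, norm_iteratedFDeriv_one]
    simp only [fderiv_fun_id, pow_one, mul_inv_cancel₀ hσ.ne']
    exact ContinuousLinearMap.norm_id_le
  · rw [← norm_iteratedFDeriv_fderiv]
    have : fderiv ℝ (fun y : E => y) = fun _ => ContinuousLinearMap.id ℝ E := by
      ext1 y; exact fderiv_fun_id
    rw [this, iteratedFDeriv_succ_const]
    simp only [Pi.zero_apply, norm_zero]
    positivity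

end CompositionBound

section Weight

variable {V : Type*} [NormedAddCommGroup V] [InnerProductSpace ℝ V]

theorem norm_iteratedFDeriv_one_add_norm_sq_le (i : ℕ) (hi : 1 ≤ i) (x : V) :
    ‖iteratedFDeriv ℝ i (fun y : V => 1 + ‖y‖ ^ 2) x‖
      ≤ (1 + ‖x‖ ^ 2) * (2 * (√(1 + ‖x‖ ^ 2))⁻¹) ^ i := by
  have hσ : 0 < √(1 + ‖x‖ ^ 2) := by positivity
  have hxσ : ‖x‖ ≤ √(1 + ‖x‖ ^ 2) := Real.le_sqrt_of_sq_le (by linarith)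
  have hid := fun j => norm_iteratedFDeriv_id_le j x hσ hxσ
  have hadd : iteratedFDeriv ℝ i (fun y : V => 1 + ‖y‖ ^ 2) x
      = iteratedFDeriv ℝ i (fun y : V => innerSL ℝ y y) x := by
    have h : (fun y : V => 1 + ‖y‖ ^ 2) = (fun _ => (1 : ℝ)) + fun y : V => innerSL ℝ y y := by
      ext y
      simp
    have hc : ContDiff ℝ i (fun y : V => innerSL ℝ y y) :=
      (innerSL ℝ).isBoundedBilinearMap.contDiff.comp (contDiff_id.prodMk contDiff_id)
    rw [h, iteratedFDeriv_add_apply contDiff_const.contDiffAt hc.contDiffAt,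
      iteratedFDeriv_const_of_ne (by omega)]
    simp
  rw [hadd]
  refine ((innerSL ℝ).norm_iteratedFDeriv_le_of_bilinear_of_le_one (N := i) contDiff_id contDiff_id
    x le_rfl (norm_innerSL_le ℝ)).trans ?_
  calc _ ≤ ∑ j ∈ Finset.range (i + 1), (i.choose j : ℝ) * (√(1 + ‖x‖ ^ 2) *
        (√(1 + ‖x‖ ^ 2))⁻¹ ^ j) * (√(1 + ‖x‖ ^ 2) * (√(1 + ‖x‖ ^ 2))⁻¹ ^ (i - j)) := by
        gcongr with j hj
        · exact hid j
        · exact hid (i - j)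
    _ = ∑ j ∈ Finset.range (i + 1), (i.choose j : ℝ) *
        ((1 + ‖x‖ ^ 2) * (√(1 + ‖x‖ ^ 2))⁻¹ ^ i) := by
        refine Finset.sum_congr rfl fun j hj => ?_
        have hji : j + (i - j) = i := by have := Finset.mem_range.1 hj; omega
        have hsq := Real.sq_sqrt (show 0 ≤ 1 + ‖x‖ ^ 2 by positivity)
        have hpow := pow_add (√(1 + ‖x‖ ^ 2))⁻¹ j (i - j)
        rw [hji] at hpow
        rw [hpow, ← hsq, Real.sqrt_sq hσ.le]
        ring
    _ = _ := by
        rw [← Finset.sum_mul, ← Nat.cast_sum, Nat.sum_range_choose, mul_pow]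
        push_cast
        ring

theorem norm_iteratedFDeriv_sqrt (i : ℕ) {y : ℝ} (hy : 0 < y) :
    ‖iteratedFDeriv ℝ i Real.sqrt y‖ = |(descPochhammer ℝ i).eval (1 / 2)| * (√y * (y ^ i)⁻¹) := by
  have h : Real.sqrt = fun x : ℝ => x ^ (1 / 2 : ℝ) := funext Real.sqrt_eq_rpow
  rw [norm_iteratedFDeriv_eq_norm_iteratedDeriv, iteratedDeriv_eq_iterate, h,
    Real.iter_deriv_rpow_const, norm_mul, Real.norm_eq_abs, Real.rpow_sub_natCast hy.ne', norm_div,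
    norm_pow, Real.norm_of_nonneg hy.le, Real.norm_of_nonneg (by positivity)]
  rfl

theorem exists_norm_iteratedFDeriv_weight_le (V : Type*) [NormedAddCommGroup V]
    [InnerProductSpace ℝ V] (i : ℕ) : ∃ K : ℝ, ∀ x : V,
      ‖iteratedFDeriv ℝ i (fun y : V => √(1 + ‖y‖ ^ 2)) x‖
        ≤ K * (√(1 + ‖x‖ ^ 2) * (√(1 + ‖x‖ ^ 2))⁻¹ ^ i) := by
  let P : ℝ := ∑ j ∈ Finset.range (i + 1), |(descPochhammer ℝ j).eval (1 / 2)|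
  refine ⟨i ! * P * 2 ^ i, fun x => ?_⟩
  have hq : 0 < 1 + ‖x‖ ^ 2 := by positivity
  have := norm_iteratedFDeriv_comp_le_of_scaled (g := Real.sqrt) (f := fun y : V => 1 + ‖y‖ ^ 2)
    (n := i) (t := Set.Ioi 0) isOpen_Ioi (fun y => by simp only [Set.mem_Ioi]; positivity)
    (fun y hy => (Real.contDiffAt_sqrt (ne_of_gt hy)).contDiffWithinAt)
    (contDiff_const.add (contDiff_norm_sq ℝ)) x (C := P * √(1 + ‖x‖ ^ 2))
    (D := 2 * (√(1 + ‖x‖ ^ 2))⁻¹) hq ?_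
    (fun j hj _ => norm_iteratedFDeriv_one_add_norm_sq_le j hj x)
  · refine this.trans (le_of_eq ?_)
    rw [mul_pow]
    ring
  · intro j hj
    rw [norm_iteratedFDeriv_sqrt j hq]
    have hP : |(descPochhammer ℝ j).eval (1 / 2)| ≤ P :=
      Finset.single_le_sum (f := fun j => |(descPochhammer ℝ j).eval (1 / 2 : ℝ)|)
        (fun _ _ => abs_nonneg _) (Finset.mem_range.2 (by omega))
    calc _ = |(descPochhammer ℝ j).eval (1 / 2)| * √(1 + ‖x‖ ^ 2) := by field_simp
      _ ≤ _ := by gcongr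

theorem contDiff_weight : ContDiff ℝ (⊤ : ℕ∞) fun y : V => √(1 + ‖y‖ ^ 2) :=
  (contDiff_const.add (contDiff_norm_sq ℝ)).sqrt fun y => by positivity

theorem exists_norm_iteratedFDeriv_slice_le (V : Type*) [NormedAddCommGroup V]
    [InnerProductSpace ℝ V] (n : ℕ) : ∃ K : ℝ, 1 ≤ K ∧ ∀ i ≤ n, ∀ τ : ℝ, |τ| ≤ 1 → ∀ x : V,
      ‖iteratedFDeriv ℝ i (fun y : V => (y, τ * √(1 + ‖y‖ ^ 2))) x‖
        ≤ K * (√(1 + ‖x‖ ^ 2) * (√(1 + ‖x‖ ^ 2))⁻¹ ^ i) := by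
  choose K hK using exists_norm_iteratedFDeriv_weight_le V
  refine ⟨1 + ∑ j ∈ Finset.range (n + 1), |K j|, ?_, fun i hi τ hτ x => ?_⟩
  · have : 0 ≤ ∑ j ∈ Finset.range (n + 1), |K j| := by positivity
    linarith
  have hσ : 0 < √(1 + ‖x‖ ^ 2) := by positivity
  have hxσ : ‖x‖ ≤ √(1 + ‖x‖ ^ 2) := Real.le_sqrt_of_sq_le (by linarith)
  have hw : ContDiff ℝ i fun y : V => √(1 + ‖y‖ ^ 2) :=
    contDiff_weight.of_le (by exact_mod_cast le_top)
  have hS : |K i| ≤ ∑ j ∈ Finset.range (n + 1), |K j| :=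
    Finset.single_le_sum (f := fun j => |K j|) (fun _ _ => abs_nonneg _)
      (Finset.mem_range.2 (by omega))
  have hS0 := (abs_nonneg (K i)).trans hS
  rw [iteratedFDeriv_prodMk (n := i) contDiff_fun_id.contDiffAt (contDiff_const.mul hw).contDiffAt le_rfl,
    ContinuousMultilinearMap.opNorm_prod]
  refine max_le ?_ ?_
  · refine (norm_iteratedFDeriv_id_le i x hσ hxσ).trans (le_mul_of_one_le_left ?_ ?_)
    · positivity
    · linarith
  · have : (fun y : V => τ * √(1 + ‖y‖ ^ 2)) = τ • fun y : V => √(1 + ‖y‖ ^ 2) := rfl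
    rw [this, iteratedFDeriv_const_smul_apply hw.contDiffAt, norm_smul]
    calc _ ≤ 1 * (K i * (√(1 + ‖x‖ ^ 2) * (√(1 + ‖x‖ ^ 2))⁻¹ ^ i)) := by
          gcongr
          · exact hτ
          · exact hK i x
      _ ≤ _ := by
          rw [one_mul]
          gcongr
          linarith [le_abs_self (K i)]

end Weight

section TimeDerivative

variable {n : ℕ}

theorem timeDeriv_eq_fderiv_apply {u : EuclideanSpace ℝ (Fin n) × ℝ → ℝ}
    (hu : Differentiable ℝ u) : timeDeriv u = fun p => fderiv ℝ u p (0, 1) := by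
  ext p
  have h : HasDerivAt (fun t : ℝ => (p.1, t)) (0, 1) p.2 :=
    (hasDerivAt_const _ _).prodMk (hasDerivAt_id _)
  exact ((hu p).hasFDerivAt.comp_hasDerivAt p.2 h).deriv

theorem contDiff_timeDeriv_iterate {u : EuclideanSpace ℝ (Fin n) × ℝ → ℝ}
    (hu : ContDiff ℝ (⊤ : ℕ∞) u) (k : ℕ) : ContDiff ℝ (⊤ : ℕ∞) (timeDeriv^[k] u) := by
  induction k with
  | zero => exact hu
  | succ k ih =>
    rw [Function.iterate_succ_apply', timeDeriv_eq_fderiv_apply (ih.differentiable (by simp))]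
    exact (ih.fderiv_right (m := (⊤ : ℕ∞)) (by simp)).clm_apply contDiff_const

theorem norm_iteratedFDeriv_timeDeriv_iterate_le {u : EuclideanSpace ℝ (Fin n) × ℝ → ℝ}
    (hu : ContDiff ℝ (⊤ : ℕ∞) u) (k i : ℕ) (p : EuclideanSpace ℝ (Fin n) × ℝ) :
    ‖iteratedFDeriv ℝ i (timeDeriv^[k] u) p‖ ≤ ‖iteratedFDeriv ℝ (i + k) u p‖ := by
  induction k generalizing i with
  | zero => exact le_rfl
  | succ k ih =>
    have hk := contDiff_timeDeriv_iterate hu k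
    rw [Function.iterate_succ_apply', timeDeriv_eq_fderiv_apply (hk.differentiable (by simp))]
    have hf : ContDiff ℝ (⊤ : ℕ∞) (fderiv ℝ (timeDeriv^[k] u)) := hk.fderiv_right (by simp)
    refine (norm_iteratedFDeriv_clm_apply_const hf.contDiffAt
      (by exact_mod_cast le_top)).trans ?_
    rw [norm_iteratedFDeriv_fderiv, show i + (k + 1) = i + 1 + k by ring]
    simpa [Prod.norm_def] using ih (i + 1)

end TimeDerivative

section Trace

theorem sq_integral_le_mul_integral_sq {a b : ℝ} (hab : a < b) {h : ℝ → ℝ} (hc : Continuous h) :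
    (∫ t in a..b, h t) ^ 2 ≤ (b - a) * ∫ t in a..b, h t ^ 2 := by
  set A := ∫ t in a..b, h t with hA
  have hpos : 0 ≤ ∫ t in a..b, ((b - a) * h t - A) ^ 2 :=
    intervalIntegral.integral_nonneg hab.le fun t _ => sq_nonneg _
  have hexp : ∫ t in a..b, ((b - a) * h t - A) ^ 2
      = (b - a) ^ 2 * (∫ t in a..b, h t ^ 2) - 2 * (b - a) * A * A + (b - a) * A ^ 2 := by
    have : ∀ t, ((b - a) * h t - A) ^ 2
        = (b - a) ^ 2 * h t ^ 2 - 2 * (b - a) * A * h t + A ^ 2 := fun t => by ring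
    simp_rw [this]
    have i1 : IntervalIntegrable (fun t => (b - a) ^ 2 * h t ^ 2) volume a b :=
      Continuous.intervalIntegrable (by fun_prop) _ _
    have i2 : IntervalIntegrable (fun t => 2 * (b - a) * A * h t) volume a b :=
      Continuous.intervalIntegrable (by fun_prop) _ _
    rw [intervalIntegral.integral_add (i1.sub i2) (by simp), intervalIntegral.integral_sub i1 i2,
      intervalIntegral.integral_const_mul, intervalIntegral.integral_const_mul,
      intervalIntegral.integral_const, smul_eq_mul, ← hA]
  rw [hexp] at hpos
  have hba : 0 < b - a := by linarith
  refine le_of_mul_le_mul_left ?_ hba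
  linarith

variable {X : Type*} [NormedAddCommGroup X] [NormedSpace ℝ X] [CompleteSpace X]

theorem norm_sq_le_of_hasDerivAt {F F' : ℝ → X} {g : ℝ → ℝ} (hF : ∀ t, HasDerivAt F (F' t) t)
    (hF' : Continuous F') (hg : Continuous g) (hFg : ∀ t, ‖F' t‖ ≤ g t) {a b c : ℝ}
    (hab : a < b) (hc : c ∈ Set.Icc a b) :
    (b - a) * ‖F c‖ ^ 2
      ≤ 2 * (∫ t in a..b, ‖F t‖ ^ 2) + 2 * (b - a) ^ 2 * ∫ t in a..b, g t ^ 2 := by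
  have hFc : Continuous F := continuous_iff_continuousAt.2 fun t => (hF t).continuousAt
  have hg0 : ∀ t, 0 ≤ g t := fun t => (norm_nonneg _).trans (hFg t)
  have hpt : ∀ t ∈ Set.Icc a b,
      ‖F c‖ ^ 2 ≤ 2 * ‖F t‖ ^ 2 + 2 * ((b - a) * ∫ r in a..b, g r ^ 2) := by
    intro t ht
    have h1 : F c - F t = ∫ r in t..c, F' r :=
      (intervalIntegral.integral_eq_sub_of_hasDerivAt (fun r _ => hF r)
        (hF'.intervalIntegrable _ _)).symm
    have h2 : ‖F c - F t‖ ≤ ∫ r in a..b, g r := by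
      rw [h1]
      refine intervalIntegral.norm_integral_le_integral_norm_uIoc.trans ?_
      rw [intervalIntegral.integral_of_le hab.le]
      have hsub : Set.uIoc t c ⊆ Set.Ioc a b := by
        rw [Set.uIoc]
        exact Set.Ioc_subset_Ioc (le_min ht.1 hc.1) (max_le ht.2 hc.2)
      have hgi : IntegrableOn g (Set.Ioc a b) := (hg.integrableOn_Icc).mono_set Set.Ioc_subset_Icc_self
      calc _ ≤ ∫ r in Set.uIoc t c, g r := by
            refine integral_mono ?_ (hgi.mono_set hsub) fun r => hFg r
            exact (hF'.norm.integrableOn_uIcc (a := t) (b := c)).mono_set Set.uIoc_subset_uIcc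
        _ ≤ _ := setIntegral_mono_set hgi (Filter.Eventually.of_forall hg0)
            hsub.eventuallyLE
    have h3 := sq_integral_le_mul_integral_sq hab hg
    have h4 : ‖F c‖ ≤ ‖F t‖ + ∫ r in a..b, g r := by
      have := norm_add_le (F t) (F c - F t)
      rw [add_sub_cancel] at this
      linarith
    nlinarith [norm_nonneg (F c), sq_nonneg (‖F t‖ - ∫ r in a..b, g r)]
  have hint := intervalIntegral.integral_mono_on hab.le (by simp)
    (Continuous.intervalIntegrable (by fun_prop) a b) hpt (μ := volume)
  have i1 : IntervalIntegrable (fun t => 2 * ‖F t‖ ^ 2) volume a b :=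
      Continuous.intervalIntegrable (by fun_prop) _ _
  rw [intervalIntegral.integral_const, intervalIntegral.integral_add i1 (by simp),
    intervalIntegral.integral_const_mul, intervalIntegral.integral_const, smul_eq_mul,
    smul_eq_mul] at hint
  linarith

end Trace

section Slice

variable {n : ℕ}

theorem exists_weighted_slice_deriv_le (n s : ℕ) (δ : ℝ) : ∃ K : ℝ, 0 < K ∧
    ∀ τ : ℝ, |τ| ≤ 1 → ∀ u : EuclideanSpace ℝ (Fin n) × ℝ → ℝ, ContDiff ℝ (⊤ : ℕ∞) u →
    ∀ k j : ℕ, j + k ≤ s → ∀ x : EuclideanSpace ℝ (Fin n),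
      (1 + ‖x‖ ^ 2) ^ (δ + 1 / 2 + k + j) *
          ‖iteratedFDeriv ℝ j (fun y => (timeDeriv^[k] u) (y, τ * √(1 + ‖y‖ ^ 2))) x‖ ^ 2
        ≤ K * ∑ m ∈ Finset.range (s + 1), (1 + ‖x‖ ^ 2) ^ (δ + 1 / 2 + m) *
          ‖iteratedFDeriv ℝ m u (x, τ * √(1 + ‖x‖ ^ 2))‖ ^ 2 := by
  obtain ⟨K, hK1, hK⟩ := exists_norm_iteratedFDeriv_slice_le (EuclideanSpace ℝ (Fin n)) s
  refine ⟨(s ! * K ^ s) ^ 2 * (s + 1), by positivity, fun τ hτ u hu k j hjk x => ?_⟩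
  set σ := √(1 + ‖x‖ ^ 2) with hσdef
  have hσ : 0 < σ := by positivity
  have hq : 0 < 1 + ‖x‖ ^ 2 := by positivity
  have hσq : σ ^ 2 = 1 + ‖x‖ ^ 2 := Real.sq_sqrt hq.le
  set S := ∑ m ∈ Finset.range (s + 1), σ ^ m * ‖iteratedFDeriv ℝ m u (x, τ * σ)‖ with hS
  have hS0 : 0 ≤ S := by positivity
  have hw := contDiff_timeDeriv_iterate hu k
  have hbound := norm_iteratedFDeriv_comp_le_of_scaled (g := timeDeriv^[k] u)
    (f := fun y : EuclideanSpace ℝ (Fin n) => (y, τ * √(1 + ‖y‖ ^ 2))) (n := j) isOpen_univ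
    (fun _ => Set.mem_univ _) (hw.of_le (by exact_mod_cast le_top)).contDiffOn
    ((contDiff_id.prodMk (contDiff_const.mul contDiff_weight)).of_le (by exact_mod_cast le_top))
    x (C := (σ ^ k)⁻¹ * S) (D := K * σ⁻¹) hσ ?_ ?_
  · have hb : σ ^ (j + k) * ‖iteratedFDeriv ℝ j
        (fun y => (timeDeriv^[k] u) (y, τ * √(1 + ‖y‖ ^ 2))) x‖ ≤ s ! * K ^ s * S := by
      calc _ ≤ σ ^ (j + k) * (j ! * ((σ ^ k)⁻¹ * S) * (K * σ⁻¹) ^ j) := by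
            gcongr
            exact hbound
        _ = j ! * K ^ j * S := by
            rw [mul_pow, inv_pow, pow_add]
            field_simp
        _ ≤ s ! * K ^ s * S := by
            gcongr
            · omega
            · omega
    have hsq := pow_le_pow_left₀ (by positivity) hb 2
    have hcs : S ^ 2 ≤ (s + 1) * ∑ m ∈ Finset.range (s + 1),
        (σ ^ m * ‖iteratedFDeriv ℝ m u (x, τ * σ)‖) ^ 2 := by
      simpa using sq_sum_le_card_mul_sum_sq (s := Finset.range (s + 1))
        (f := fun m => σ ^ m * ‖iteratedFDeriv ℝ m u (x, τ * σ)‖)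
    have hpow : ∀ m : ℕ, (1 + ‖x‖ ^ 2) ^ (δ + 1 / 2 + m)
        = (1 + ‖x‖ ^ 2) ^ (δ + 1 / 2) * (σ ^ m) ^ 2 := fun m => by
      rw [Real.rpow_add_natCast hq.ne', ← hσq]
      ring
    have hpow' : δ + 1 / 2 + k + j = δ + 1 / 2 + ((j + k : ℕ) : ℝ) := by
      push_cast
      ring
    rw [hpow']
    simp_rw [hpow, mul_assoc, ← Finset.mul_sum, ← mul_pow]
    calc _ ≤ (1 + ‖x‖ ^ 2) ^ (δ + 1 / 2) * (s ! * K ^ s * S) ^ 2 := by gcongr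
      _ ≤ (1 + ‖x‖ ^ 2) ^ (δ + 1 / 2) * ((s ! * K ^ s) ^ 2 * ((s + 1) *
          ∑ m ∈ Finset.range (s + 1), (σ ^ m * ‖iteratedFDeriv ℝ m u (x, τ * σ)‖) ^ 2)) := by
          rw [mul_pow _ S]
          gcongr
      _ = _ := by ring
  · intro i hi
    have hmem : i + k ∈ Finset.range (s + 1) := Finset.mem_range.2 (by omega)
    have hle : σ ^ (i + k) * ‖iteratedFDeriv ℝ (i + k) u (x, τ * σ)‖ ≤ S :=
      Finset.single_le_sum (f := fun m => σ ^ m * ‖iteratedFDeriv ℝ m u (x, τ * σ)‖)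
        (fun _ _ => by positivity) hmem
    rw [le_inv_mul_iff₀ (by positivity)]
    calc _ ≤ σ ^ k * (σ ^ i * ‖iteratedFDeriv ℝ (i + k) u (x, τ * σ)‖) := by
          gcongr
          exact norm_iteratedFDeriv_timeDeriv_iterate_le hu k i _
      _ = σ ^ (i + k) * ‖iteratedFDeriv ℝ (i + k) u (x, τ * σ)‖ := by ring
      _ ≤ S := hle
  · intro i h1 hi
    refine (hK i (by omega) τ hτ x).trans ?_
    have hKi : K ≤ K ^ i := le_self_pow₀ hK1 (by omega)
    calc _ ≤ K ^ i * (σ * σ⁻¹ ^ i) := by gcongr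
      _ = _ := by ring

theorem measurableSet_boostRegion (n : ℕ) (θ : ℝ) : MeasurableSet (boostRegion n θ) :=
  (isClosed_le (by fun_prop) (by fun_prop)).measurableSet

theorem setLIntegral_boostRegion (θ : ℝ) {f : EuclideanSpace ℝ (Fin n) × ℝ → ENNReal}
    (hf : Measurable f) : ∫⁻ p in boostRegion n θ, f p
      = ∫⁻ x, ∫⁻ t in Set.Icc (-(θ * √(1 + ‖x‖ ^ 2))) (θ * √(1 + ‖x‖ ^ 2)), f (x, t) := by
  have hm := measurableSet_boostRegion n θ
  rw [← lintegral_indicator hm, Measure.volume_eq_prod,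
    lintegral_prod _ (hf.indicator hm).aemeasurable]
  refine lintegral_congr fun x => ?_
  rw [← lintegral_indicator measurableSet_Icc]
  refine lintegral_congr fun t => ?_
  simp only [Set.indicator, boostRegion, Set.mem_ofPred_eq, abs_le, Set.mem_Icc]

theorem continuous_weight_mul_norm_iteratedFDeriv_sq {u : EuclideanSpace ℝ (Fin n) × ℝ → ℝ}
    (hu : ContDiff ℝ (⊤ : ℕ∞) u) (r : ℝ) (m : ℕ) :
    Continuous fun p : EuclideanSpace ℝ (Fin n) × ℝ =>
      (1 + ‖p.1‖ ^ 2) ^ r * ‖iteratedFDeriv ℝ m u p‖ ^ 2 := by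
  have h1 : Continuous (iteratedFDeriv ℝ m u) :=
    hu.continuous_iteratedFDeriv (by exact_mod_cast le_top)
  have h2 : Continuous fun p : EuclideanSpace ℝ (Fin n) × ℝ => (1 + ‖p.1‖ ^ 2) ^ r :=
    Continuous.rpow_const (by fun_prop) fun p => Or.inl (by positivity)
  fun_prop

theorem weighted_trace_le {θ : ℝ} (hθ : 0 < θ) {τ : ℝ} (hτ : |τ| ≤ θ) (δ : ℝ) (m : ℕ)
    {u : EuclideanSpace ℝ (Fin n) × ℝ → ℝ} (hu : ContDiff ℝ (⊤ : ℕ∞) u)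
    (x : EuclideanSpace ℝ (Fin n)) :
    (1 + ‖x‖ ^ 2) ^ (δ + 1 / 2 + m) * ‖iteratedFDeriv ℝ m u (x, τ * √(1 + ‖x‖ ^ 2))‖ ^ 2
      ≤ (1 / θ + 4 * θ) * ∫ t in (-(θ * √(1 + ‖x‖ ^ 2)))..(θ * √(1 + ‖x‖ ^ 2)),
        ((1 + ‖x‖ ^ 2) ^ (δ + m) * ‖iteratedFDeriv ℝ m u (x, t)‖ ^ 2
          + (1 + ‖x‖ ^ 2) ^ (δ + (m + 1 : ℕ)) * ‖iteratedFDeriv ℝ (m + 1) u (x, t)‖ ^ 2) := by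
  set σ := √(1 + ‖x‖ ^ 2) with hσdef
  have hσ : 0 < σ := by positivity
  have hq : 0 < 1 + ‖x‖ ^ 2 := by positivity
  have hσq : σ ^ 2 = 1 + ‖x‖ ^ 2 := Real.sq_sqrt hq.le
  have hD : ∀ k, ContDiff ℝ 1 (iteratedFDeriv ℝ k u) := fun k =>
    hu.iteratedFDeriv_right (by exact_mod_cast le_top)
  have hline : Continuous fun t : ℝ => (x, t) := by fun_prop
  have hderiv : ∀ t, HasDerivAt (fun t => iteratedFDeriv ℝ m u (x, t))
      (fderiv ℝ (iteratedFDeriv ℝ m u) (x, t) (0, 1)) t := fun t =>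
    (((hD m).differentiable (by simp)) (x, t)).hasFDerivAt.comp_hasDerivAt t
      ((hasDerivAt_const t x).prodMk (hasDerivAt_id t))
  have hc0 : Continuous fun t : ℝ => iteratedFDeriv ℝ m u (x, t) := (hD m).continuous.comp hline
  have hc1 : Continuous fun t : ℝ => iteratedFDeriv ℝ (m + 1) u (x, t) :=
    (hD (m + 1)).continuous.comp hline
  have htr := norm_sq_le_of_hasDerivAt (a := -(θ * σ)) (b := θ * σ) (c := τ * σ) hderiv
    ((((hD m).continuous_fderiv (by simp)).comp hline).clm_apply continuous_const)
    hc1.norm (fun t => ?_) (by nlinarith [mul_pos hθ hσ]) ?_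
  · rw [intervalIntegral.integral_add (Continuous.intervalIntegrable (by fun_prop) _ _)
      (Continuous.intervalIntegrable (by fun_prop) _ _), intervalIntegral.integral_const_mul,
      intervalIntegral.integral_const_mul]
    set A := ∫ t in (-(θ * σ))..(θ * σ), ‖iteratedFDeriv ℝ m u (x, t)‖ ^ 2 with hA
    set B := ∫ t in (-(θ * σ))..(θ * σ), ‖iteratedFDeriv ℝ (m + 1) u (x, t)‖ ^ 2 with hB
    have hle : -(θ * σ) ≤ θ * σ := by nlinarith [mul_pos hθ hσ]
    have hA0 : 0 ≤ A := intervalIntegral.integral_nonneg hle fun t _ => by positivity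
    have hB0 : 0 ≤ B := intervalIntegral.integral_nonneg hle fun t _ => by positivity
    set W := (1 + ‖x‖ ^ 2) ^ (δ + m) with hW
    have hW0 : 0 < W := by positivity
    have hW1 : (1 + ‖x‖ ^ 2) ^ (δ + 1 / 2 + m) = W * σ := by
      rw [hσdef, Real.sqrt_eq_rpow, hW, ← Real.rpow_add hq]
      ring_nf
    have hW2 : (1 + ‖x‖ ^ 2) ^ (δ + (m + 1 : ℕ)) = W * σ ^ 2 := by
      rw [hσq, hW, ← Real.rpow_add_one hq.ne']
      push_cast
      ring_nf
    rw [hW1, hW2]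
    set N := ‖iteratedFDeriv ℝ m u (x, τ * σ)‖ ^ 2
    have h1 : σ * N ≤ 1 / θ * A + 4 * θ * (σ ^ 2 * B) := by
      refine le_of_mul_le_mul_left ?_ (show 0 < 2 * θ by positivity)
      have : 2 * θ * (1 / θ * A + 4 * θ * (σ ^ 2 * B)) = 2 * A + 8 * θ ^ 2 * σ ^ 2 * B := by
        field_simp
        ring
      rw [this]
      linarith
    have h2 : 0 ≤ 4 * θ * A := by positivity
    have h3 : 0 ≤ 1 / θ * (σ ^ 2 * B) := by positivity
    calc W * σ * N = W * (σ * N) := by ring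
      _ ≤ W * ((1 / θ + 4 * θ) * (A + σ ^ 2 * B)) := by
          refine mul_le_mul_of_nonneg_left ?_ hW0.le
          linarith
      _ = _ := by ring
  · refine (ContinuousLinearMap.le_opNorm _ _).trans ?_
    rw [norm_fderiv_iteratedFDeriv]
    simp [Prod.norm_def]
  · obtain ⟨h1, h2⟩ := abs_le.1 hτ
    constructor <;> nlinarith

theorem lintegral_weighted_slice_le {θ : ℝ} (hθ : 0 < θ) {τ : ℝ} (hτ : |τ| ≤ θ) (δ : ℝ) (m : ℕ)
    {u : EuclideanSpace ℝ (Fin n) × ℝ → ℝ} (hu : ContDiff ℝ (⊤ : ℕ∞) u) :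
    ∫⁻ x : EuclideanSpace ℝ (Fin n), ENNReal.ofReal ((1 + ‖x‖ ^ 2) ^ (δ + 1 / 2 + m) *
        ‖iteratedFDeriv ℝ m u (x, τ * √(1 + ‖x‖ ^ 2))‖ ^ 2)
      ≤ ENNReal.ofReal (1 / θ + 4 * θ) *
        ((∫⁻ p in boostRegion n θ, ENNReal.ofReal ((1 + ‖p.1‖ ^ 2) ^ (δ + m) *
            ‖iteratedFDeriv ℝ m u p‖ ^ 2)) +
          ∫⁻ p in boostRegion n θ, ENNReal.ofReal ((1 + ‖p.1‖ ^ 2) ^ (δ + (m + 1 : ℕ)) *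
            ‖iteratedFDeriv ℝ (m + 1) u p‖ ^ 2)) := by
  have hc := fun (r : ℝ) (k : ℕ) => continuous_weight_mul_norm_iteratedFDeriv_sq hu r k
  have hm := fun (r : ℝ) (k : ℕ) => (hc r k).measurable.ennreal_ofReal
  rw [← lintegral_add_left (hm (δ + m) m), setLIntegral_boostRegion θ
    (f := fun p => ENNReal.ofReal ((1 + ‖p.1‖ ^ 2) ^ (δ + m) * ‖iteratedFDeriv ℝ m u p‖ ^ 2)
      + ENNReal.ofReal ((1 + ‖p.1‖ ^ 2) ^ (δ + (m + 1 : ℕ)) * ‖iteratedFDeriv ℝ (m + 1) u p‖ ^ 2))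
    ((hm (δ + m) m).add (hm (δ + (m + 1 : ℕ)) (m + 1))),
    ← lintegral_const_mul' _ _ ENNReal.ofReal_ne_top]
  refine lintegral_mono fun x => ?_
  have hab : -(θ * √(1 + ‖x‖ ^ 2)) ≤ θ * √(1 + ‖x‖ ^ 2) := by
    have : 0 ≤ θ * √(1 + ‖x‖ ^ 2) := by positivity
    linarith
  have hline : Continuous fun t : ℝ => (x, t) := by fun_prop
  have hcx : Continuous fun t : ℝ =>
      (1 + ‖x‖ ^ 2) ^ (δ + m) * ‖iteratedFDeriv ℝ m u (x, t)‖ ^ 2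
        + (1 + ‖x‖ ^ 2) ^ (δ + (m + 1 : ℕ)) * ‖iteratedFDeriv ℝ (m + 1) u (x, t)‖ ^ 2 := by
    have hD : ∀ k, Continuous fun t : ℝ => iteratedFDeriv ℝ k u (x, t) := fun k =>
      (hu.continuous_iteratedFDeriv (m := k) (by exact_mod_cast le_top)).comp hline
    have h0 := hD m
    have h1 := hD (m + 1)
    fun_prop
  refine (ENNReal.ofReal_le_ofReal (weighted_trace_le hθ hτ δ m hu x)).trans_eq ?_
  rw [ENNReal.ofReal_mul (by positivity), intervalIntegral.integral_of_le hab,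
    ← integral_Icc_eq_integral_Ioc, ofReal_integral_eq_lintegral_ofReal hcx.integrableOn_Icc
      (Filter.Eventually.of_forall fun t => by positivity)]
  congr 1
  refine lintegral_congr fun t => ?_
  rw [ENNReal.ofReal_add (by positivity) (by positivity)]

end Slice

theorem ENNReal.rpow_half_sq (a : ENNReal) : (a ^ (1 / 2 : ℝ)) ^ 2 = a := by
  rw [← ENNReal.rpow_natCast, ← ENNReal.rpow_mul]
  norm_num

/-- **Restriction (trace) lemma on the boost region**: there is `C = C(n, θ, s, δ)` such
that for every `τ ∈ (−θ, θ)` and every smooth `u` with finite `H_{s+1,δ}(Ω_θ)`-norm,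
`Σ_{k=0}^{s} ‖x ↦ (∂_t^k u)(x, τσ(x))‖²_{H_{s−k, δ+1/2+k}(ℝⁿ)} ≤ C ‖u‖²_{H_{s+1,δ}(Ω_θ)}`. -/
theorem weighted_sobolev_restriction_boost
    (n : ℕ) (hn : 1 ≤ n) (θ : ℝ) (hθ : θ ∈ Set.Ioc (0 : ℝ) 1) (s : ℕ) (δ : ℝ) :
    ∃ C : ℝ, 0 < C ∧
      ∀ τ : ℝ, τ ∈ Set.Ioo (-θ) θ →
      ∀ u : EuclideanSpace ℝ (Fin n) × ℝ → ℝ, ContDiff ℝ (⊤ : ℕ∞) u →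
        wSobOn n (s + 1) δ (boostRegion n θ) u < ⊤ →
        ∑ k ∈ Finset.range (s + 1),
            (wSob n (s - k) (δ + 1/2 + k)
              (fun x => (timeDeriv^[k] u) (x, τ * Real.sqrt (1 + ‖x‖ ^ 2)))) ^ 2
          ≤ ENNReal.ofReal C * (wSobOn n (s + 1) δ (boostRegion n θ) u) ^ 2 := by
  obtain ⟨hθ0, hθ1⟩ := hθ
  obtain ⟨K, hK0, hK⟩ := exists_weighted_slice_deriv_le n s δ
  refine ⟨((s + 1 : ℕ) : ℝ) * (((s + 1 : ℕ) : ℝ) *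
    (K * (((s + 1 : ℕ) : ℝ) * ((1 / θ + 4 * θ) * 2)))), by positivity, ?_⟩
  intro τ hτ u hu _
  have hτθ : |τ| ≤ θ := (abs_lt.2 hτ).le
  simp only [wSobOn, wSob, ENNReal.rpow_half_sq]
  set N := ∑ k ∈ Finset.range (s + 1 + 1), ∫⁻ p in boostRegion n θ,
    ENNReal.ofReal ((1 + ‖p.1‖ ^ 2) ^ (δ + (k : ℝ)) * ‖iteratedFDeriv ℝ k u p‖ ^ 2) with hN
  have hslice : ∀ m ∈ Finset.range (s + 1),
      ∫⁻ x : EuclideanSpace ℝ (Fin n), ENNReal.ofReal ((1 + ‖x‖ ^ 2) ^ (δ + 1 / 2 + m) *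
        ‖iteratedFDeriv ℝ m u (x, τ * √(1 + ‖x‖ ^ 2))‖ ^ 2)
      ≤ ENNReal.ofReal (1 / θ + 4 * θ) * (2 * N) := by
    intro m hm
    have hm := Finset.mem_range.1 hm
    have hle : ∀ k < s + 1 + 1, ∫⁻ p in boostRegion n θ, ENNReal.ofReal
        ((1 + ‖p.1‖ ^ 2) ^ (δ + (k : ℝ)) * ‖iteratedFDeriv ℝ k u p‖ ^ 2) ≤ N := fun k hk =>
      Finset.single_le_sum (f := fun k : ℕ => ∫⁻ p in boostRegion n θ, ENNReal.ofReal
        ((1 + ‖p.1‖ ^ 2) ^ (δ + (k : ℝ)) * ‖iteratedFDeriv ℝ k u p‖ ^ 2))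
        (fun _ _ => zero_le) (Finset.mem_range.2 hk)
    refine (lintegral_weighted_slice_le hθ0 hτθ δ m hu).trans ?_
    rw [two_mul]
    gcongr
    · exact hle m (by omega)
    · exact hle (m + 1) (by omega)
  have hterm : ∀ k ∈ Finset.range (s + 1), ∀ j ∈ Finset.range (s - k + 1),
      ∫⁻ x : EuclideanSpace ℝ (Fin n), ENNReal.ofReal ((1 + ‖x‖ ^ 2) ^ (δ + 1 / 2 + k + (j : ℝ)) *
        ‖iteratedFDeriv ℝ j (fun x => (timeDeriv^[k] u) (x, τ * √(1 + ‖x‖ ^ 2))) x‖ ^ 2)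
      ≤ ENNReal.ofReal K * ((s + 1 : ℕ) * (ENNReal.ofReal (1 / θ + 4 * θ) * (2 * N))) := by
    intro k hk j hj
    have hk := Finset.mem_range.1 hk
    have hj := Finset.mem_range.1 hj
    calc _ ≤ ∫⁻ x : EuclideanSpace ℝ (Fin n), ENNReal.ofReal K * ∑ m ∈ Finset.range (s + 1),
          ENNReal.ofReal ((1 + ‖x‖ ^ 2) ^ (δ + 1 / 2 + m) *
            ‖iteratedFDeriv ℝ m u (x, τ * √(1 + ‖x‖ ^ 2))‖ ^ 2) := by
          refine lintegral_mono fun x => ?_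
          rw [← ENNReal.ofReal_sum_of_nonneg fun _ _ => by positivity, ← ENNReal.ofReal_mul hK0.le]
          exact ENNReal.ofReal_le_ofReal (hK τ (hτθ.trans hθ1) u hu k j (by omega) x)
      _ = ENNReal.ofReal K * ∑ m ∈ Finset.range (s + 1), ∫⁻ x : EuclideanSpace ℝ (Fin n),
          ENNReal.ofReal ((1 + ‖x‖ ^ 2) ^ (δ + 1 / 2 + m) *
            ‖iteratedFDeriv ℝ m u (x, τ * √(1 + ‖x‖ ^ 2))‖ ^ 2) := by
          rw [lintegral_const_mul' _ _ ENNReal.ofReal_ne_top, lintegral_finsetSum]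
          intro m _
          have hφ : Continuous fun x : EuclideanSpace ℝ (Fin n) => (x, τ * √(1 + ‖x‖ ^ 2)) := by
            fun_prop
          exact ((continuous_weight_mul_norm_iteratedFDeriv_sq hu (δ + 1 / 2 + m) m).comp
            hφ).measurable.ennreal_ofReal
      _ ≤ _ := by
          gcongr
          simpa [nsmul_eq_mul] using Finset.sum_le_card_nsmul _ _ _ hslice
  calc _ ≤ ∑ k ∈ Finset.range (s + 1), ((s + 1 : ℕ) : ENNReal) *
        (ENNReal.ofReal K * ((s + 1 : ℕ) * (ENNReal.ofReal (1 / θ + 4 * θ) * (2 * N)))) := by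
        refine Finset.sum_le_sum fun k hk => ?_
        refine (Finset.sum_le_card_nsmul _ _ _ (hterm k hk)).trans ?_
        rw [nsmul_eq_mul, Finset.card_range]
        gcongr
        omega
    _ = _ := by
        rw [Finset.sum_const, nsmul_eq_mul, Finset.card_range, ENNReal.ofReal_mul (by positivity),
          ENNReal.ofReal_mul (by positivity), ENNReal.ofReal_mul (by positivity),
          ENNReal.ofReal_mul (by positivity), ENNReal.ofReal_mul (by positivity),
          ENNReal.ofReal_natCast, ENNReal.ofReal_ofNat]
        ring
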